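/- Let g : ℝ → ℝ be bounded continuous with ∫ g dπ = 0, and let φ ∈ C²(ℝ) solve (m − y)φ′(y) + (1/2)σ₂(y)²φ″(y) = g(y) on ℝ with the boundary condition E(y)·φ′(y) → 0 as y → −∞. Then for every bounded continuous w : ℝ → ℝ, both of the following integrals converge absolutely and ∫_ℝ w(y)·φ′(y) dπ(y) = ∫_ℝ (2·w(y)/σ₂(y)²)·(∫_{−∞}^y g dπ) dy. (Taking w = ρσ₁σ₂ and g = (σ₁² − σ̄²)/2 gives the alternate formula A = ρ·∫_ℝ (σ₁(y)/σ₂(y))·(∫_{−∞}^y (σ₁² − σ̄²) dπ) dy, and taking w = (ρ + η√(1−ρ²))·bσ₂/σ₁ gives the corresponding formula for B.) -/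

import Mathlib

open MeasureTheory

noncomputable section

/-- `E(y) = exp(∫₀^y 2(m - z)/σ₂(z)² dz)`. -/
def Efun (m : ℝ) (σ₂ : ℝ → ℝ) (y : ℝ) : ℝ :=
  Real.exp (∫ z in (0:ℝ)..y, 2 * (m - z) / (σ₂ z) ^ 2)

/-- The normalizing constant `Z = ∫_ℝ E(y)/σ₂(y)² dy`. -/
def Zconst (m : ℝ) (σ₂ : ℝ → ℝ) : ℝ :=
  ∫ y : ℝ, Efun m σ₂ y / (σ₂ y) ^ 2

/-- The invariant measure `π` on `ℝ` with density `p(y) = Z⁻¹·E(y)/σ₂(y)²`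
with respect to Lebesgue measure. -/
def pimeas (m : ℝ) (σ₂ : ℝ → ℝ) : Measure ℝ :=
  volume.withDensity fun y => ENNReal.ofReal ((Zconst m σ₂)⁻¹ * (Efun m σ₂ y / (σ₂ y) ^ 2))

end

open Filter Topology Set

lemma Efun_pos (m : ℝ) (σ₂ : ℝ → ℝ) (y : ℝ) : 0 < Efun m σ₂ y := Real.exp_pos _

lemma hasDerivAt_drift_integral {m : ℝ} {σ₂ : ℝ → ℝ} (hσ : Continuous σ₂)
    (hpos : ∀ y, 0 < σ₂ y) (y : ℝ) :
    HasDerivAt (fun y => ∫ z in (0:ℝ)..y, 2 * (m - z) / (σ₂ z) ^ 2)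
      (2 * (m - y) / (σ₂ y) ^ 2) y := by
  have hc : Continuous fun z => 2 * (m - z) / (σ₂ z) ^ 2 :=
    Continuous.div (by fun_prop) (by fun_prop) fun z => (pow_pos (hpos z) 2).ne'
  exact (hc.integral_hasStrictDerivAt 0 y).hasDerivAt

lemma hasDerivAt_Efun {m : ℝ} {σ₂ : ℝ → ℝ} (hσ : Continuous σ₂)
    (hpos : ∀ y, 0 < σ₂ y) (y : ℝ) :
    HasDerivAt (Efun m σ₂) (Efun m σ₂ y * (2 * (m - y) / (σ₂ y) ^ 2)) y :=
  (hasDerivAt_drift_integral hσ hpos y).exp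

lemma continuous_Efun {m : ℝ} {σ₂ : ℝ → ℝ} (hσ : Continuous σ₂)
    (hpos : ∀ y, 0 < σ₂ y) : Continuous (Efun m σ₂) :=
  continuous_iff_continuousAt.2 fun y => (hasDerivAt_Efun hσ hpos y).continuousAt

/-- Gaussian upper bound for the scale function. -/
lemma Efun_le_gaussian {m C : ℝ} {σ₂ : ℝ → ℝ} (hσ : Continuous σ₂)
    (hpos : ∀ y, 0 < σ₂ y) (hC : ∀ y, σ₂ y ≤ C) (y : ℝ) :
    Efun m σ₂ y ≤ Efun m σ₂ m * Real.exp (-(1 / C ^ 2) * (y - m) ^ 2) := by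
  set F : ℝ → ℝ := fun y =>
    (∫ z in (0:ℝ)..y, 2 * (m - z) / (σ₂ z) ^ 2) + 1 / C ^ 2 * (y - m) ^ 2 with hF
  have hd : ∀ x, HasDerivAt F (2 * (m - x) * (1 / (σ₂ x) ^ 2 - 1 / C ^ 2)) x := by
    intro x
    have h := (hasDerivAt_drift_integral (m := m) hσ hpos x).add
      ((((hasDerivAt_id x).sub_const m).pow 2).const_mul (1 / C ^ 2))
    refine h.congr_deriv ?_
    simp only [id]
    push_cast
    ring
  have hcoef : ∀ x, 0 ≤ 1 / (σ₂ x) ^ 2 - 1 / C ^ 2 := fun x =>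
    sub_nonneg.2 (one_div_le_one_div_of_le (pow_pos (hpos x) 2)
      (pow_le_pow_left₀ (hpos x).le (hC x) 2))
  have hcont : Continuous F :=
    continuous_iff_continuousAt.2 fun x => (hd x).continuousAt
  have key : F y ≤ F m := by
    rcases le_total y m with h | h
    · refine monotoneOn_of_hasDerivWithinAt_nonneg (convex_Iic m) hcont.continuousOn
        (fun x _ => (hd x).hasDerivWithinAt) (fun x hx => ?_) h self_mem_Iic h
      rw [interior_Iic] at hx
      exact mul_nonneg (by linarith [mem_Iio.1 hx]) (hcoef x)
    · refine antitoneOn_of_hasDerivWithinAt_nonpos (convex_Ici m) hcont.continuousOn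
        (fun x _ => (hd x).hasDerivWithinAt) (fun x hx => ?_) self_mem_Ici h h
      rw [interior_Ici] at hx
      exact mul_nonpos_of_nonpos_of_nonneg (by linarith [mem_Ioi.1 hx]) (hcoef x)
  rw [Efun, Efun, ← Real.exp_add]
  refine Real.exp_le_exp.2 ?_
  simp only [hF, sub_self] at key
  linarith

lemma integrable_Efun {m C : ℝ} {σ₂ : ℝ → ℝ} (hσ : Continuous σ₂)
    (hpos : ∀ y, 0 < σ₂ y) (hC : ∀ y, σ₂ y ≤ C) : Integrable (Efun m σ₂) := by
  have hC0 : 0 < C := (hpos 0).trans_le (hC 0)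
  have hg := ((integrable_exp_neg_mul_sq (b := 1 / C ^ 2) (by positivity)).comp_sub_right
    m).const_mul (Efun m σ₂ m)
  refine hg.mono' (continuous_Efun hσ hpos).aestronglyMeasurable (ae_of_all _ fun y => ?_)
  rw [Real.norm_of_nonneg (Efun_pos m σ₂ y).le]
  exact Efun_le_gaussian hσ hpos hC y

lemma tendsto_Efun_zero {m C : ℝ} {σ₂ : ℝ → ℝ} (hσ : Continuous σ₂)
    (hpos : ∀ y, 0 < σ₂ y) (hC : ∀ y, σ₂ y ≤ C) {l : Filter ℝ}
    (hl : Tendsto (fun y => |y - m|) l atTop) : Tendsto (Efun m σ₂) l (𝓝 0) := by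
  have hC0 : 0 < C := (hpos 0).trans_le (hC 0)
  have h1 : Tendsto (fun y => -(1 / C ^ 2) * (y - m) ^ 2) l atBot := by
    have := ((tendsto_pow_atTop two_ne_zero).comp hl).const_mul_atTop_of_neg
      (r := -(1 / C ^ 2)) (by have : 0 < 1 / C ^ 2 := by positivity
                              linarith)
    refine this.congr fun y => ?_
    simp [sq_abs]
  have h2 := (Real.tendsto_exp_atBot.comp h1).const_mul (Efun m σ₂ m)
  rw [mul_zero] at h2
  exact squeeze_zero (fun y => (Efun_pos m σ₂ y).le) (Efun_le_gaussian hσ hpos hC) h2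

lemma integrable_Efun_div_sq {m c C : ℝ} {σ₂ : ℝ → ℝ} (hσ : Continuous σ₂)
    (hc : 0 < c) (hb : ∀ y, c ≤ σ₂ y ∧ σ₂ y ≤ C) :
    Integrable (fun y => Efun m σ₂ y / (σ₂ y) ^ 2) := by
  have hpos : ∀ y, 0 < σ₂ y := fun y => hc.trans_le (hb y).1
  refine ((integrable_Efun (m := m) hσ hpos fun y => (hb y).2).div_const (c ^ 2)).mono'
    ((continuous_Efun hσ hpos).div (by fun_prop)
      fun z => (pow_pos (hpos z) 2).ne').aestronglyMeasurable (ae_of_all _ fun y => ?_)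
  have hE := Efun_pos m σ₂ y
  rw [Real.norm_of_nonneg (by positivity)]
  exact div_le_div_of_nonneg_left hE.le (by positivity) (pow_le_pow_left₀ hc.le (hb y).1 2)

lemma Zconst_pos {m c C : ℝ} {σ₂ : ℝ → ℝ} (hσ : Continuous σ₂)
    (hc : 0 < c) (hb : ∀ y, c ≤ σ₂ y ∧ σ₂ y ≤ C) : 0 < Zconst m σ₂ := by
  have hpos : ∀ y, 0 < σ₂ y := fun y => hc.trans_le (hb y).1
  have hp : ∀ y, 0 < Efun m σ₂ y / (σ₂ y) ^ 2 := fun y =>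
    div_pos (Efun_pos m σ₂ y) (pow_pos (hpos y) 2)
  exact integral_pos_of_integrable_nonneg_nonzero (x := 0)
    ((continuous_Efun hσ hpos).div (by fun_prop) fun z => (pow_pos (hpos z) 2).ne')
    (integrable_Efun_div_sq hσ hc hb) (fun y => (hp y).le) (hp 0).ne'

lemma setIntegral_pimeas {m c C : ℝ} {σ₂ : ℝ → ℝ} (hσ : Continuous σ₂)
    (hc : 0 < c) (hb : ∀ y, c ≤ σ₂ y ∧ σ₂ y ≤ C) (f : ℝ → ℝ) {s : Set ℝ}
    (hs : MeasurableSet s) :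
    ∫ y in s, f y ∂(pimeas m σ₂) =
      ∫ y in s, (Zconst m σ₂)⁻¹ * (Efun m σ₂ y / (σ₂ y) ^ 2) * f y := by
  have hpos : ∀ y, 0 < σ₂ y := fun y => hc.trans_le (hb y).1
  have hZ : 0 < Zconst m σ₂ := Zconst_pos hσ hc hb
  have hcont : Continuous fun y => (Zconst m σ₂)⁻¹ * (Efun m σ₂ y / (σ₂ y) ^ 2) :=
    continuous_const.mul ((continuous_Efun hσ hpos).div (by fun_prop)
      fun z => (pow_pos (hpos z) 2).ne')
  rw [pimeas, setIntegral_withDensity_eq_setIntegral_toReal_smul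
    hcont.measurable.ennreal_ofReal (ae_of_all _ fun y => ENNReal.ofReal_lt_top) _ hs]
  refine integral_congr_ae (ae_of_all _ fun y => ?_)
  have hE := Efun_pos m σ₂ y
  simp only [smul_eq_mul]
  rw [ENNReal.toReal_ofReal (by positivity)]

lemma integrable_pimeas_iff {m c C : ℝ} {σ₂ : ℝ → ℝ} (hσ : Continuous σ₂)
    (hc : 0 < c) (hb : ∀ y, c ≤ σ₂ y ∧ σ₂ y ≤ C) {f : ℝ → ℝ} :
    Integrable f (pimeas m σ₂) ↔
      Integrable fun y => (Zconst m σ₂)⁻¹ * (Efun m σ₂ y / (σ₂ y) ^ 2) * f y := by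
  have hpos : ∀ y, 0 < σ₂ y := fun y => hc.trans_le (hb y).1
  have hZ : 0 < Zconst m σ₂ := Zconst_pos hσ hc hb
  have hcont : Continuous fun y => (Zconst m σ₂)⁻¹ * (Efun m σ₂ y / (σ₂ y) ^ 2) :=
    continuous_const.mul ((continuous_Efun hσ hpos).div (by fun_prop)
      fun z => (pow_pos (hpos z) 2).ne')
  rw [pimeas, integrable_withDensity_iff_integrable_smul'
    hcont.measurable.ennreal_ofReal (ae_of_all _ fun y => ENNReal.ofReal_lt_top)]
  refine integrable_congr (ae_of_all _ fun y => ?_)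
  have hE := Efun_pos m σ₂ y
  simp only [smul_eq_mul]
  rw [ENNReal.toReal_ofReal (by positivity)]

/-- A function vanishing at `-∞` whose derivative is dominated by that of another such function
is dominated by it. -/
lemma abs_le_of_abs_deriv_le_of_tendsto_atBot {f F f' F' : ℝ → ℝ} {a : ℝ}
    (hf : ∀ x, HasDerivAt f (f' x) x) (hF : ∀ x, HasDerivAt F (F' x) x)
    (hle : ∀ x < a, |f' x| ≤ F' x) (hf0 : Tendsto f atBot (𝓝 0))
    (hF0 : Tendsto F atBot (𝓝 0)) {y : ℝ} (hy : y ≤ a) : |f y| ≤ F y := by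
  have aux : ∀ u u' : ℝ → ℝ, (∀ x, HasDerivAt u (u' x) x) → (∀ x < a, 0 ≤ u' x) →
      Tendsto u atBot (𝓝 0) → 0 ≤ u y := by
    intro u u' hu hu' hu0
    have hmono : MonotoneOn u (Iic a) := by
      refine monotoneOn_of_hasDerivWithinAt_nonneg (convex_Iic a)
        (continuous_iff_continuousAt.2 fun x => (hu x).continuousAt).continuousOn
        (fun x _ => (hu x).hasDerivWithinAt) fun x hx => ?_
      rw [interior_Iic] at hx
      exact hu' x hx
    refine le_of_tendsto hu0 ?_
    filter_upwards [eventually_le_atBot y] with x hx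
    exact hmono (hx.trans hy) hy hx
  rw [abs_le]
  constructor
  · have := aux (fun x => F x + f x) _ (fun x => (hF x).add (hf x))
      (fun x hx => by linarith [(abs_le.1 (hle x hx)).1]) (by simpa using hF0.add hf0)
    linarith
  · have := aux (fun x => F x - f x) _ (fun x => (hF x).sub (hf x))
      (fun x hx => by linarith [(abs_le.1 (hle x hx)).2]) (by simpa using hF0.sub hf0)
    linarith

/-- A function vanishing at `+∞` whose derivative is dominated by the negated derivative of
another such function is dominated by it. -/
lemma abs_le_of_abs_deriv_le_of_tendsto_atTop {f F f' F' : ℝ → ℝ} {a : ℝ}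
    (hf : ∀ x, HasDerivAt f (f' x) x) (hF : ∀ x, HasDerivAt F (F' x) x)
    (hle : ∀ x, a < x → |f' x| ≤ -F' x) (hf0 : Tendsto f atTop (𝓝 0))
    (hF0 : Tendsto F atTop (𝓝 0)) {y : ℝ} (hy : a ≤ y) : |f y| ≤ F y := by
  have hneg : ∀ {u u' : ℝ → ℝ}, (∀ x, HasDerivAt u (u' x) x) →
      ∀ x, HasDerivAt (fun x => u (-x)) (-u' (-x)) x := fun hu x => by
    simpa [Function.comp_def] using (hu (-x)).comp x (hasDerivAt_neg x)
  have := abs_le_of_abs_deriv_le_of_tendsto_atBot (a := -a) (y := -y) (hneg hf) (hneg hF)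
    (fun x hx => by rw [abs_neg]; exact hle (-x) (by linarith))
    (hf0.comp tendsto_neg_atBot_atTop) (hF0.comp tendsto_neg_atBot_atTop) (by linarith)
  simpa using this

/-- if `g` is bounded continuous with `∫ g dπ = 0` and `φ ∈ C²`
solves `(m-y)φ′ + (1/2)σ₂²φ″ = g` with `E(y)φ′(y) → 0` as `y → -∞`, then for
every bounded continuous `w`, both integrals below converge absolutely and
`∫ w·φ′ dπ = ∫ (2w/σ₂²)·(∫_{-∞}^y g dπ) dy`. -/
theorem phi_prime_integral_identity
    (m c₂ C₂ : ℝ) (σ₂ : ℝ → ℝ) (hσ₂c : Continuous σ₂)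
    (hc₂ : 0 < c₂) (hσ₂ : ∀ y, c₂ ≤ σ₂ y ∧ σ₂ y ≤ C₂)
    (g : ℝ → ℝ) (hgc : Continuous g) (hgb : ∃ M, ∀ y, |g y| ≤ M)
    (hcent : ∫ y, g y ∂(pimeas m σ₂) = 0)
    (φ : ℝ → ℝ) (hφ : ContDiff ℝ 2 φ)
    (hpoisson : ∀ y : ℝ,
      (m - y) * deriv φ y + (1/2) * (σ₂ y) ^ 2 * deriv (deriv φ) y = g y)
    (hbdry : Filter.Tendsto (fun y => Efun m σ₂ y * deriv φ y) Filter.atBot (nhds 0)) :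
    ∀ w : ℝ → ℝ, Continuous w → (∃ M, ∀ y, |w y| ≤ M) →
      Integrable (fun y => w y * deriv φ y) (pimeas m σ₂) ∧
      Integrable (fun y => 2 * w y / (σ₂ y) ^ 2 * ∫ u in Set.Iic y, g u ∂(pimeas m σ₂)) ∧
      ∫ y, w y * deriv φ y ∂(pimeas m σ₂)
        = ∫ y : ℝ, 2 * w y / (σ₂ y) ^ 2 * ∫ u in Set.Iic y, g u ∂(pimeas m σ₂) := by
  have hpos : ∀ y, 0 < σ₂ y := fun y => hc₂.trans_le (hσ₂ y).1
  have hσ2pos : ∀ y, 0 < (σ₂ y) ^ 2 := fun y => pow_pos (hpos y) 2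
  have hZ : 0 < Zconst m σ₂ := Zconst_pos hσ₂c hc₂ hσ₂
  have hEp := Efun_pos m σ₂
  have hEd := hasDerivAt_Efun (m := m) hσ₂c hpos
  obtain ⟨M, hM⟩ := hgb
  have hM0 : 0 ≤ M := (abs_nonneg _).trans (hM 0)
  have hφ1 : ContDiff ℝ 1 (deriv φ) :=
    ContDiff.deriv' (n := 1) (by simpa [one_add_one_eq_two] using hφ)
  have hφ'c : Continuous (deriv φ) := hφ1.continuous
  have hφ'd : ∀ y, HasDerivAt (deriv φ) (deriv (deriv φ) y) y := fun y =>
    (hφ1.differentiable one_ne_zero y).hasDerivAt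
  have hhd : ∀ y, HasDerivAt (fun y => Efun m σ₂ y * deriv φ y)
      (Efun m σ₂ y / (σ₂ y) ^ 2 * (2 * g y)) y := fun y => by
    refine ((hEd y).mul (hφ'd y)).congr_deriv ?_
    rw [← hpoisson y]
    field_simp [(hpos y).ne']
  have hint : Integrable fun y => Efun m σ₂ y / (σ₂ y) ^ 2 * (2 * g y) := by
    refine (integrable_Efun_div_sq hσ₂c hc₂ hσ₂).mul_bdd (c := 2 * M)
      (by fun_prop) (ae_of_all _ fun y => ?_)
    rw [norm_mul, Real.norm_eq_abs, Real.norm_eq_abs, abs_two]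
    linarith [hM y]
  have hscale : ∀ s : Set ℝ, MeasurableSet s →
      ∫ y in s, Efun m σ₂ y / (σ₂ y) ^ 2 * (2 * g y) =
        2 * Zconst m σ₂ * ∫ y in s, g y ∂(pimeas m σ₂) := fun s hs => by
    rw [setIntegral_pimeas hσ₂c hc₂ hσ₂ g hs, ← integral_const_mul]
    refine integral_congr_ae (ae_of_all _ fun y => ?_)
    field_simp
  have hflux : ∀ y, Efun m σ₂ y * deriv φ y =
      2 * Zconst m σ₂ * ∫ u in Iic y, g u ∂(pimeas m σ₂) := fun y => by
    rw [← hscale _ measurableSet_Iic,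
      integral_Iic_of_hasDerivAt_of_tendsto' (fun x _ => hhd x) hint.integrableOn hbdry, sub_zero]
  have htop : Tendsto (fun y => Efun m σ₂ y * deriv φ y) atTop (𝓝 0) := by
    have h := (aecover_Iic tendsto_id).integral_tendsto_of_countably_generated hint
    have hzero : ∫ y, Efun m σ₂ y / (σ₂ y) ^ 2 * (2 * g y) = 0 := by
      rw [← setIntegral_univ, hscale _ MeasurableSet.univ, setIntegral_univ, hcent, mul_zero]
    rw [hzero] at h
    refine h.congr fun y => ?_
    rw [hflux y, ← hscale _ measurableSet_Iic]
    rfl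
  have hEM : ∀ y, HasDerivAt (fun y => M * Efun m σ₂ y)
      (M * (Efun m σ₂ y * (2 * (m - y) / (σ₂ y) ^ 2))) y := fun y => (hEd y).const_mul M
  have hdom : ∀ y t, 1 ≤ t → |Efun m σ₂ y / (σ₂ y) ^ 2 * (2 * g y)| ≤
      M * (Efun m σ₂ y * (2 * t / (σ₂ y) ^ 2)) := fun y t ht => by
    have hq : 0 < Efun m σ₂ y / (σ₂ y) ^ 2 := div_pos (hEp y) (hσ2pos y)
    rw [abs_mul, abs_mul, abs_two, abs_of_pos hq]
    calc Efun m σ₂ y / (σ₂ y) ^ 2 * (2 * |g y|)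
        ≤ Efun m σ₂ y / (σ₂ y) ^ 2 * (2 * (M * t)) := by
          gcongr
          nlinarith [hM y]
      _ = _ := by ring
  have hEtail : ∀ {l : Filter ℝ}, Tendsto (fun y => |y - m|) l atTop →
      Tendsto (fun y => M * Efun m σ₂ y) l (𝓝 0) := fun hl => by
    simpa using (tendsto_Efun_zero hσ₂c hpos (fun y => (hσ₂ y).2) hl).const_mul M
  have hφb : ∀ y, |Efun m σ₂ y * deriv φ y| ≤ M * Efun m σ₂ y → |deriv φ y| ≤ M := fun y h => by
    rw [abs_mul, abs_of_pos (hEp y), mul_comm M] at h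
    exact le_of_mul_le_mul_left h (hEp y)
  have hleft : ∀ y ≤ m - 1, |deriv φ y| ≤ M := fun y hy => hφb y <|
    abs_le_of_abs_deriv_le_of_tendsto_atBot hhd hEM
      (fun x hx => hdom x (m - x) (by linarith)) hbdry
      (hEtail (tendsto_abs_atBot_atTop.comp (tendsto_atBot_add_const_right _ (-m) tendsto_id))) hy
  have hright : ∀ y, m + 1 ≤ y → |deriv φ y| ≤ M := fun y hy => hφb y <|
    abs_le_of_abs_deriv_le_of_tendsto_atTop hhd hEM
      (fun x hx => (hdom x (x - m) (by linarith)).trans_eq (by ring)) htop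
      (hEtail (tendsto_abs_atTop_atTop.comp (tendsto_atTop_add_const_right _ (-m) tendsto_id))) hy
  obtain ⟨K, hK⟩ := (isCompact_Icc (a := m - 1) (b := m + 1)).exists_bound_of_continuousOn
    hφ'c.continuousOn
  have hbound : ∀ y, |deriv φ y| ≤ max M K := fun y => by
    rcases le_total y (m - 1) with h | h
    · exact (hleft y h).trans (le_max_left _ _)
    rcases le_total (m + 1) y with h' | h'
    · exact (hright y h').trans (le_max_left _ _)
    · exact (hK y ⟨h, h'⟩).trans (le_max_right _ _)
  rintro w hw ⟨N, hN⟩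
  have hpt : ∀ y, (Zconst m σ₂)⁻¹ * (Efun m σ₂ y / (σ₂ y) ^ 2) * (w y * deriv φ y) =
      2 * w y / (σ₂ y) ^ 2 * ∫ u in Iic y, g u ∂(pimeas m σ₂) := fun y => by
    calc _ = (Zconst m σ₂)⁻¹ * (Efun m σ₂ y * deriv φ y) * (w y / (σ₂ y) ^ 2) := by ring
      _ = _ := by
        rw [hflux y]
        field_simp
  have hI : Integrable fun y =>
      (Zconst m σ₂)⁻¹ * (Efun m σ₂ y / (σ₂ y) ^ 2) * (w y * deriv φ y) := by
    refine ((integrable_Efun_div_sq hσ₂c hc₂ hσ₂).const_mul _).mul_bdd (c := N * max M K)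
      (by fun_prop) (ae_of_all _ fun y => ?_)
    rw [norm_mul]
    exact mul_le_mul (hN y) (hbound y) (abs_nonneg _) ((abs_nonneg _).trans (hN y))
  refine ⟨(integrable_pimeas_iff hσ₂c hc₂ hσ₂).2 hI, hI.congr (ae_of_all _ hpt), ?_⟩
  rw [← setIntegral_univ, setIntegral_pimeas hσ₂c hc₂ hσ₂ _ MeasurableSet.univ, setIntegral_univ]
  exact integral_congr_ae (ae_of_all _ hpt)
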